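/- arXiv:2410.21188 — 4 statements merged into one kernel-verified Lean document; each statement's English description precedes it below -/
import Mathlib

section
/- Pumping lemma for DPN unboundedness: let N be a DPN with initial state (M_I, α_I), and suppose (M, α) ∈ Reach_N and there is a nonempty trace σ with (M, α) →σ (M', α) such that M'(p) ≥ M(p) for all p ∈ P and M' ≠ M. Then for every k ∈ ℕ the state (M_k, α) with M_k(p) = M(p) + k·(M'(p) − M(p)) belongs to Reach_N; consequently, N is not bounded. -/
/-- Comparison operators appearing in atomic arithmetic constraints. -/
inductive CmpOp : Type
  | lt | eq | gt

def CmpOp.eval : CmpOp → ℝ → ℝ → Prop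
  | .lt, a, b => a < b
  | .eq, a, b => a = b
  | .gt, a, b => a > b

/-- Arithmetic constraints over a variable set `X`:
`φ ::= ⊤ | x ⊙ y | x ⊙ c | ¬φ | φ₁ ∧ φ₂`. -/
inductive AC (X : Type) : Type
  | top : AC X
  | atomVV : X → CmpOp → X → AC X
  | atomVC : X → CmpOp → ℝ → AC X
  | neg : AC X → AC X
  | and : AC X → AC X → AC X

/-- Satisfaction of an arithmetic constraint by a total assignment. -/
def AC.sat {X : Type} : AC X → (X → ℝ) → Prop
  | .top, _ => True
  | .atomVV x op y, θ => op.eval (θ x) (θ y)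
  | .atomVC x op c, θ => op.eval (θ x) c
  | .neg φ, θ => ¬ φ.sat θ
  | .and φ ψ, θ => φ.sat θ ∧ ψ.sat θ

/-- Variables occurring in an arithmetic constraint. -/
def AC.vars {X : Type} : AC X → Set X
  | .top => ∅
  | .atomVV x _ y => {x, y}
  | .atomVC x _ _ => {x}
  | .neg φ => φ.vars
  | .and φ ψ => φ.vars ∪ ψ.vars

/-- `⟦φ⟧`: the set of total assignments satisfying `φ`. -/
def AC.sem {X : Type} (φ : AC X) : Set (X → ℝ) := {θ | φ.sat θ}

/-- A Data Petri Net over places `P`, transitions `T` and variables `V`.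
Guards are arithmetic constraints over `V^r ∪ V^w`, encoded as `V ⊕ V`
(`Sum.inl v` is `v^r`, `Sum.inr v` is `v^w`).  `pre p t = F(p,t)`,
`post t p = F(t,p)`. -/
structure DPN (P T V : Type) : Type where
  pre : P → T → ℕ
  post : T → P → ℕ
  guard : T → AC (V ⊕ V)

namespace DPN

variable {P T V : Type}

/-- `write t`: variables `v` such that `v^w` occurs in `guard t`. -/
def write (N : DPN P T V) (t : T) : Set V := {v | Sum.inr v ∈ (N.guard t).vars}

/-- Transition firing `(M, α) →t (M', α')`. -/
def fires (N : DPN P T V) (M : P → ℕ) (α : V → ℝ) (t : T) (M' : P → ℕ) (α' : V → ℝ) : Prop :=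
  (∀ p, N.pre p t ≤ M p) ∧
  (∀ p, M' p = M p - N.pre p t + N.post t p) ∧
  (N.guard t).sat (Sum.elim α α') ∧
  (∀ v, v ∉ N.write t → α' v = α v)

/-- The reachability set of `N` from initial state `(MI, αI)`. -/
inductive Reach (N : DPN P T V) (MI : P → ℕ) (αI : V → ℝ) : (P → ℕ) → (V → ℝ) → Prop
  | init : Reach N MI αI MI αI
  | step {M α t M' α'} : Reach N MI αI M α → N.fires M α t M' α' → Reach N MI αI M' α'

/-- Firing of a trace `σ`: `(M, α) →σ (M', α')`. -/
def firesSeq (N : DPN P T V) : (P → ℕ) → (V → ℝ) → List T → (P → ℕ) → (V → ℝ) → Prop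
  | M, α, [], M', α' => M = M' ∧ α = α'
  | M, α, t :: σ, M'', α'' => ∃ M' α', N.fires M α t M' α' ∧ N.firesSeq M' α' σ M'' α''

/-- Data-aware soundness of `N` w.r.t. initial state `(MI, αI)` and final marking `MF`. -/
def Sound (N : DPN P T V) (MI MF : P → ℕ) (αI : V → ℝ) : Prop :=
  (∀ M α, N.Reach MI αI M α → ∃ σ α', N.firesSeq M α σ MF α') ∧
  (∀ M α, N.Reach MI αI M α → (∀ p, MF p ≤ M p) → M = MF) ∧
  (∀ t : T, ∃ M₁ α₁ M₂ α₂, N.Reach MI αI M₁ α₁ ∧ N.fires M₁ α₁ t M₂ α₂)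

end DPN

/-- `N'` is a guard restriction of `N`: same places, transitions, flow and variables,
with `⟦guard'(t)⟧ ⊆ ⟦guard(t)⟧` and `write'(t) = write(t)` for every `t`. -/
def GuardRestriction {P T V : Type} (N' N : DPN P T V) : Prop :=
  N'.pre = N.pre ∧ N'.post = N.post ∧
  ∀ t, (N'.guard t).sem ⊆ (N.guard t).sem ∧ N'.write t = N.write t

namespace DPN

variable {P T V : Type}

theorem fires.add_marking {N : DPN P T V} {M M' : P → ℕ} {α α' : V → ℝ} {t : T}
    (h : N.fires M α t M' α') (D : P → ℕ) : N.fires (M + D) α t (M' + D) α' := by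
  obtain ⟨hpre, hpost, hguard, hwrite⟩ := h
  refine ⟨fun p => ?_, fun p => ?_, hguard, hwrite⟩
  · exact (hpre p).trans (Nat.le_add_right _ _)
  · have h₁ := hpre p
    have h₂ := hpost p
    simp only [Pi.add_apply]
    omega

theorem firesSeq.add_marking {N : DPN P T V} {σ : List T} {M M' : P → ℕ} {α α' : V → ℝ}
    (h : N.firesSeq M α σ M' α') (D : P → ℕ) : N.firesSeq (M + D) α σ (M' + D) α' := by
  induction σ generalizing M α with
  | nil => exact ⟨congrArg (· + D) h.1, h.2⟩
  | cons t σ ih =>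
    obtain ⟨M₁, α₁, hfires, hseq⟩ := h
    exact ⟨M₁ + D, α₁, hfires.add_marking D, ih hseq⟩

theorem Reach.trans_firesSeq {N : DPN P T V} {MI : P → ℕ} {αI : V → ℝ} {σ : List T}
    {M M' : P → ℕ} {α α' : V → ℝ} (hreach : N.Reach MI αI M α)
    (h : N.firesSeq M α σ M' α') : N.Reach MI αI M' α' := by
  induction σ generalizing M α with
  | nil =>
    obtain ⟨rfl, rfl⟩ := h
    exact hreach
  | cons t σ ih =>
    obtain ⟨M₁, α₁, hfires, hseq⟩ := h
    exact ih (hreach.step hfires) hseq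

end DPN

/-- pumping lemma for DPN unboundedness.  If from a reachable state
`(M, α)` a nonempty trace `σ` leads back to the same valuation with a strictly
larger marking `M'`, then every pumped marking `M + k·(M' − M)` is reachable with
valuation `α`; consequently `N` is not bounded. -/
theorem stmt10 {P T V : Type} (N : DPN P T V) (MI : P → ℕ) (αI : V → ℝ)
    (M M' : P → ℕ) (α : V → ℝ) (σ : List T)
    (hreach : N.Reach MI αI M α) (hne : σ ≠ [])
    (hfire : N.firesSeq M α σ M' α)
    (hge : ∀ p, M p ≤ M' p) (hMne : M' ≠ M) :
    (∀ k : ℕ, N.Reach MI αI (fun p => M p + k * (M' p - M p)) α) ∧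
    ¬ ∃ k : ℕ, ∀ M'' α'', N.Reach MI αI M'' α'' → ∀ p, M'' p ≤ k := by
  have hpump : ∀ k : ℕ, N.Reach MI αI (fun p => M p + k * (M' p - M p)) α := by
    intro k
    induction k with
    | zero => simpa using hreach
    | succ k ih =>
      have hstep := ih.trans_firesSeq (hfire.add_marking fun p => k * (M' p - M p))
      convert hstep using 1
      funext p
      have hp := hge p
      simp only [Pi.add_apply, Nat.succ_mul]
      omega
  refine ⟨hpump, ?_⟩
  rintro ⟨k, hk⟩
  obtain ⟨p, hp⟩ := Function.ne_iff.mp hMne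
  have hpos : 1 ≤ M' p - M p := by
    have := hge p
    omega
  have hbound := hk _ _ (hpump (k + 1)) p
  have hmul := Nat.mul_le_mul_left (k + 1) hpos
  omega
end

section
/- Repair impossibility for pure nets: let N be a DPN with V = ∅ (so every guard, being an arithmetic constraint over the empty variable set, is logically equivalent to ⊤ or to ¬⊤), with initial state (M_I, α_I) and final marking M_F. If N is not data-aware sound, then no guard restriction N' of N is data-aware sound. -/
namespace DPN

variable {P T V : Type}

/-- Reachability is monotone in the firing relation. -/
theorem Reach.of_fires_imp {N N' : DPN P T V} {MI : P → ℕ} {αI : V → ℝ}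
    (h : ∀ M α t M' α', N.fires M α t M' α' → N'.fires M α t M' α')
    {M : P → ℕ} {α : V → ℝ} (hr : N.Reach MI αI M α) : N'.Reach MI αI M α := by
  induction hr with
  | init => exact .init
  | step _ hf ih => exact .step ih (h _ _ _ _ _ hf)

theorem firesSeq.of_fires_imp {N N' : DPN P T V}
    (h : ∀ M α t M' α', N.fires M α t M' α' → N'.fires M α t M' α')
    {σ : List T} {M M' : P → ℕ} {α α' : V → ℝ} (hs : N.firesSeq M α σ M' α') :
    N'.firesSeq M α σ M' α' := by
  induction σ generalizing M α with
  | nil => exact hs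
  | cons t σ ih =>
    obtain ⟨M₁, α₁, hf, hs⟩ := hs
    exact ⟨M₁, α₁, h _ _ _ _ _ hf, ih hs⟩

/-- Soundness depends only on the firing relation. -/
theorem Sound.of_fires_iff {N N' : DPN P T V} {MI MF : P → ℕ} {αI : V → ℝ}
    (h : ∀ M α t M' α', N.fires M α t M' α' ↔ N'.fires M α t M' α')
    (hN : N.Sound MI MF αI) : N'.Sound MI MF αI := by
  have h₁ := fun M α t M' α' => (h M α t M' α').1
  have h₂ := fun M α t M' α' => (h M α t M' α').2
  obtain ⟨complete, clean, live⟩ := hN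
  refine ⟨fun M α hr => ?_, fun M α hr => clean M α (hr.of_fires_imp h₂), fun t => ?_⟩
  · obtain ⟨σ, α', hs⟩ := complete M α (hr.of_fires_imp h₂)
    exact ⟨σ, α', hs.of_fires_imp h₁⟩
  · obtain ⟨M₁, α₁, M₂, α₂, hr, hf⟩ := live t
    exact ⟨M₁, α₁, M₂, α₂, hr.of_fires_imp h₁, h₁ _ _ _ _ _ hf⟩

end DPN

/-- repair impossibility for pure nets.  If a DPN with `V = ∅`
(so every guard is logically equivalent to `⊤` or `¬⊤`) is not data-aware sound,
then no guard restriction of it is data-aware sound. -/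
theorem stmt12 {P T : Type} (N : DPN P T Empty) (MI MF : P → ℕ) (αI : Empty → ℝ)
    (hN : ¬ N.Sound MI MF αI) :
    ∀ N' : DPN P T Empty, GuardRestriction N' N → ¬ N'.Sound MI MF αI := by
  rintro N' ⟨hpre, hpost, hguard⟩ hN'
  refine hN (hN'.of_fires_iff fun M α t M' α' => ?_)
  obtain ⟨M₁, α₁, M₂, α₂, -, -, -, hsat, -⟩ := hN'.2.2 t
  have hsat' : (N'.guard t).sat (Sum.elim α α') := by
    rwa [Subsingleton.elim (Sum.elim α α') (Sum.elim α₁ α₂)]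
  have hsatN : (N.guard t).sat (Sum.elim α α') := (hguard t).1 hsat'
  simp only [DPN.fires, hpre, hpost, (hguard t).2, hsat', hsatN]
end

section
/- A data-aware sound guard restriction retains only properly terminating behavior of the source net: let N' be a guard restriction of a DPN N (same initial state (M_I, α_I) and final marking M_F), and suppose N' is data-aware sound. Then every run of N' is a prefix of a properly terminating run of N: whenever (M_I, α_I) →σ (M, α) in N', the same run (M_I, α_I) →σ (M, α) exists in N and there are a trace σ' and a valuation α' with (M, α) →σ' (M_F, α') in N. -/
/-- Every firing in a guard restriction is a firing in the source net. -/
theorem GuardRestriction.fires {P T V : Type} {N N' : DPN P T V} (h : GuardRestriction N' N)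
    {M M' : P → ℕ} {α α' : V → ℝ} {t : T} (hf : N'.fires M α t M' α') :
    N.fires M α t M' α' := by
  obtain ⟨hpre, hpost, hguard⟩ := h
  obtain ⟨henabled, hmarking, hsat, hframe⟩ := hf
  rw [hpre] at henabled hmarking
  rw [hpost] at hmarking
  rw [(hguard t).2] at hframe
  exact ⟨henabled, hmarking, (hguard t).1 hsat, hframe⟩

/-- Every run of a guard restriction is a run of the source net. -/
theorem GuardRestriction.firesSeq {P T V : Type} {N N' : DPN P T V} (h : GuardRestriction N' N)
    {σ : List T} {M M' : P → ℕ} {α α' : V → ℝ} (hf : N'.firesSeq M α σ M' α') :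
    N.firesSeq M α σ M' α' := by
  induction σ generalizing M α with
  | nil => exact hf
  | cons t σ ih =>
    obtain ⟨M₁, α₁, hfire, hrest⟩ := hf
    exact ⟨M₁, α₁, h.fires hfire, ih hrest⟩

/-- Reachability is closed under firing of traces. -/
theorem DPN.Reach.firesSeq {P T V : Type} {N : DPN P T V} {MI M M' : P → ℕ} {αI α α' : V → ℝ}
    {σ : List T} (hr : N.Reach MI αI M α) (hf : N.firesSeq M α σ M' α') :
    N.Reach MI αI M' α' := by
  induction σ generalizing M α with
  | nil =>
    obtain ⟨rfl, rfl⟩ := hf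
    exact hr
  | cons t σ ih =>
    obtain ⟨M₁, α₁, hfire, hrest⟩ := hf
    exact ih (hr.step hfire) hrest

/-- a data-aware sound guard restriction retains only properly
terminating behavior of the source net: every run of `N'` is a run of `N` and is a
prefix of a run of `N` reaching the final marking `MF`. -/
theorem stmt13 {P T V : Type} (N N' : DPN P T V) (MI MF : P → ℕ) (αI : V → ℝ)
    (hGR : GuardRestriction N' N) (hsound : N'.Sound MI MF αI) :
    ∀ (σ : List T) (M : P → ℕ) (α : V → ℝ), N'.firesSeq MI αI σ M α →
      N.firesSeq MI αI σ M α ∧ ∃ (σ' : List T) (α' : V → ℝ), N.firesSeq M α σ' MF α' := by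
  intro σ M α hrun
  obtain ⟨σ', α', hfinal⟩ := hsound.1 M α (DPN.Reach.init.firesSeq hrun)
  exact ⟨hGR.firesSeq hrun, σ', α', hGR.firesSeq hfinal⟩
end

section
/- There exists a DPN N with an initial state (M_I, α_I) and a final marking M_F whose control flow is classically sound, such that: (1) some guard restriction of N is data-aware sound; but (2) every data-aware sound guard restriction N' of N loses some correct behavior of N, i.e., for every guard restriction N' of N that is data-aware sound there exist a trace σ and valuation α' with (M_I, α_I) →σ (M_F, α') in N but not in N'. -/
/-- `N` with every guard replaced by `⊤` (its pure control flow). -/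
def DPN.topped {P T V : Type} (N : DPN P T V) : DPN P T V :=
  { pre := N.pre, post := N.post, guard := fun _ => AC.top }

namespace TokenTransfer

/-- The net with one transition moving a token from place `false` to place `true`, guarded by `g`. -/
def net (g : AC (Unit ⊕ Unit)) : DPN Bool Unit Unit where
  pre p _ := if p then 0 else 1
  post _ p := if p then 1 else 0
  guard _ := g

/-- The marking with `i` tokens in `false` and `j` tokens in `true`. -/
def mark (i j : ℕ) : Bool → ℕ := fun p => if p then j else i

/-- `x^r = 0 ∧ ¬ x^w < 0`. -/
def looseGuard : AC (Unit ⊕ Unit) :=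
  .and (.atomVC (.inl ()) .eq 0) (.neg (.atomVC (.inr ()) .lt 0))

/-- `x^r = 0 ∧ x^w = 0`. -/
def strictGuard : AC (Unit ⊕ Unit) :=
  .and (.atomVC (.inl ()) .eq 0) (.atomVC (.inr ()) .eq 0)

theorem marking_eq (M : Bool → ℕ) : M = mark (M false) (M true) := by
  funext p; cases p <;> rfl

theorem fires_mark {N : DPN Bool Unit Unit} {g : AC (Unit ⊕ Unit)} (hpre : N.pre = (net g).pre)
    (hpost : N.post = (net g).post) {i j : ℕ} {α α' : Unit → ℝ}
    (hg : (N.guard ()).sat (Sum.elim α α')) (hw : ∀ v, v ∉ N.write () → α' v = α v) :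
    N.fires (mark (i + 1) j) α () (mark i (j + 1)) α' := by
  refine ⟨fun p => ?_, fun p => ?_, hg, hw⟩ <;> cases p <;> simp [hpre, hpost, net, mark]

theorem looseGuard_sat {α α' : Unit → ℝ} :
    looseGuard.sat (Sum.elim α α') ↔ α () = 0 ∧ 0 ≤ α' () := by
  simp [looseGuard, AC.sat, CmpOp.eval]

theorem strictGuard_sat {α α' : Unit → ℝ} :
    strictGuard.sat (Sum.elim α α') ↔ α () = 0 ∧ α' () = 0 := by
  simp [strictGuard, AC.sat, CmpOp.eval]

theorem mem_write_looseGuard (v : Unit) : v ∈ (net looseGuard).write () := by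
  simp [DPN.write, net, looseGuard, AC.vars]

theorem firesSeq_mark {g : AC (Unit ⊕ Unit)} (hg : g.sat (Sum.elim 0 0)) (i j : ℕ) :
    (net g).firesSeq (mark i j) 0 (List.replicate i ()) (mark 0 (j + i)) 0 := by
  induction i generalizing j with
  | zero => exact ⟨rfl, rfl⟩
  | succ i ih =>
    refine ⟨mark i (j + 1), 0, fires_mark (g := g) rfl rfl hg fun _ _ => rfl, ?_⟩
    have h := ih (j + 1)
    rwa [add_right_comm, add_assoc] at h

theorem reach_invariant {g : AC (Unit ⊕ Unit)}
    (hzero : ∀ α', g.sat (Sum.elim 0 α') → (∀ v, v ∉ (net g).write () → α' v = 0) → α' = 0)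
    {M : Bool → ℕ} {α : Unit → ℝ} (h : (net g).Reach (mark 2 0) 0 M α) :
    α = 0 ∧ M false + M true = 2 := by
  induction h with
  | init => exact ⟨rfl, rfl⟩
  | step _ hf ih =>
    obtain ⟨rfl, hM⟩ := ih
    obtain ⟨h1, h2, h3, h4⟩ := hf
    refine ⟨hzero _ h3 h4, ?_⟩
    have e := h1 false
    have ef := h2 false
    have et := h2 true
    simp [net] at e ef et
    omega

/-- If the guard keeps the variable at `0`, moving two tokens is a data-aware sound process. -/
theorem sound_net {g : AC (Unit ⊕ Unit)} (hg : g.sat (Sum.elim 0 0))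
    (hzero : ∀ α', g.sat (Sum.elim 0 α') → (∀ v, v ∉ (net g).write () → α' v = 0) → α' = 0) :
    (net g).Sound (mark 2 0) (mark 0 2) 0 := by
  refine ⟨fun M α h => ?_, fun M α h hle => ?_, fun _ => ?_⟩
  · obtain ⟨rfl, hM⟩ := reach_invariant hzero h
    have hs := firesSeq_mark hg (M false) (M true)
    rw [add_comm (M true), hM, ← marking_eq] at hs
    exact ⟨_, 0, hs⟩
  · obtain ⟨-, hM⟩ := reach_invariant hzero h
    have ht : 2 ≤ M true := hle true
    rw [marking_eq M, show M false = 0 by omega, show M true = 2 by omega]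
  · exact ⟨_, _, _, _, .init, fires_mark (g := g) (i := 1) rfl rfl hg fun _ _ => rfl⟩

theorem firesSeq_net_looseGuard :
    (net looseGuard).firesSeq (mark 2 0) 0 [(), ()] (mark 0 2) 1 :=
  ⟨mark 1 1, 0,
    fires_mark (g := looseGuard) rfl rfl (looseGuard_sat.2 ⟨rfl, le_rfl⟩) fun _ _ => rfl,
    mark 0 2, 1,
    fires_mark (g := looseGuard) rfl rfl (looseGuard_sat.2 ⟨rfl, zero_le_one⟩)
      fun v hv => absurd (mem_write_looseGuard v) hv,
    rfl, rfl⟩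

/-- Keeping the run that ends with `x = 1` forces a deadlock: its second step can be taken first. -/
theorem not_sound_of_firesSeq {N : DPN Bool Unit Unit}
    (hN : GuardRestriction N (net looseGuard))
    (hrun : N.firesSeq (mark 2 0) 0 [(), ()] (mark 0 2) 1) :
    ¬ N.Sound (mark 2 0) (mark 0 2) 0 := by
  obtain ⟨hpre, hpost, hguard⟩ := hN
  have hsub : ∀ {α α' : Unit → ℝ}, (N.guard ()).sat (Sum.elim α α') → α () = 0 :=
    fun h => (looseGuard_sat.1 ((hguard ()).1 h)).1
  have hwrite (v : Unit) : v ∈ N.write () := (hguard ()).2 ▸ mem_write_looseGuard v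
  obtain ⟨_, α, _, _, _, h, rfl, rfl⟩ := hrun
  obtain rfl : α = 0 := funext fun _ => hsub h.2.2.1
  intro hsound
  obtain ⟨σ, α', hσ⟩ := hsound.1 (mark 1 1) 1
    (.step .init (fires_mark hpre hpost h.2.2.1 fun v hv => absurd (hwrite v) hv))
  cases σ with
  | nil => exact absurd (congrFun hσ.1 false) one_ne_zero
  | cons =>
    obtain ⟨_, _, hf, -⟩ := hσ
    exact one_ne_zero (hsub hf.2.2.1)

end TokenTransfer

/-- there is a DPN with a classically sound control flow such that
some guard restriction of it is data-aware sound, but every data-aware sound guard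
restriction loses some correct behavior: some run of the original net to the final
marking is not a run of the restricted net. -/
theorem stmt16 : ∃ (P T V : Type) (N : DPN P T V) (MI MF : P → ℕ) (αI : V → ℝ),
    (DPN.topped N).Sound MI MF αI ∧
    (∃ N' : DPN P T V, GuardRestriction N' N ∧ N'.Sound MI MF αI) ∧
    ∀ N' : DPN P T V, GuardRestriction N' N → N'.Sound MI MF αI →
      ∃ (σ : List T) (α' : V → ℝ),
        N.firesSeq MI αI σ MF α' ∧ ¬ N'.firesSeq MI αI σ MF α' := by
  open TokenTransfer in
  refine ⟨Bool, Unit, Unit, net looseGuard, mark 2 0, mark 0 2, 0, ?_, ?_, ?_⟩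
  · exact sound_net (g := .top) trivial
      fun α' _ h => funext fun v => h v (by simp [DPN.write, net, AC.vars])
  · refine ⟨net strictGuard, ⟨rfl, rfl, fun _ => ⟨fun θ hθ => ?_, rfl⟩⟩, ?_⟩
    · exact ⟨hθ.1, not_lt.2 (ge_of_eq hθ.2)⟩
    · exact sound_net (strictGuard_sat.2 ⟨rfl, rfl⟩)
        fun α' h _ => funext fun _ => (strictGuard_sat.1 h).2
  · exact fun N' hN' hsound =>
      ⟨_, _, firesSeq_net_looseGuard, fun hrun => not_sound_of_firesSeq hN' hrun hsound⟩
end
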